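/- Let p ∈ (0,1) and a, b ∈ ℝ, and for each real n with pn + a > 0 and (1−p)n + b > 0 let W_n be a Beta(pn + a, (1−p)n + b) random variable. Suppose one of the following holds: (i) p ≤ 1/2 and either (a ≥ 1 ≥ b) or (a+b−2)((a−1)/(a+b−2) − p) > 0; (ii) p ≥ 1/2 and either (b ≥ 1 ≥ a) or (a+b−2)((a−1)/(a+b−2) − p) < 0. Then the function n ↦ P(W_n ≤ p) is monotone in n on its domain and tends to 1/2 as n → ∞. -/

import Mathlib

/-- `P(W ≤ t)` for `W ~ Beta(a, b)`: the normalised lower incomplete beta integral. -/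
noncomputable def betaCDF (a b t : ℝ) : ℝ :=
  (∫ x in (0 : ℝ)..t, x ^ (a - 1) * (1 - x) ^ (b - 1)) /
    (∫ x in (0 : ℝ)..(1 : ℝ), x ^ (a - 1) * (1 - x) ^ (b - 1))

section Aux
open MeasureTheory Set Filter Topology

theorem cheb_aux (k R h : ℝ → ℝ)
    (hk : ∀ v ∈ Ioi (0:ℝ), 0 < k v)
    (hR : MonotoneOn R (Ioi 0)) (hh : AntitoneOn h (Ioi 0))
    (i1 : IntegrableOn k (Ioi 0)) (i2 : IntegrableOn (fun v => k v * h v) (Ioi 0))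
    (i3 : IntegrableOn (fun v => R v * k v) (Ioi 0))
    (i4 : IntegrableOn (fun v => R v * (k v * h v)) (Ioi 0)) :
    (∫ v in Ioi (0:ℝ), R v * (k v * h v)) * (∫ v in Ioi (0:ℝ), k v) ≤
    (∫ v in Ioi (0:ℝ), R v * k v) * (∫ v in Ioi (0:ℝ), k v * h v) := by
  set a := ∫ v in Ioi (0:ℝ), R v * (k v * h v)
  set b := ∫ v in Ioi (0:ℝ), k v
  set c := ∫ v in Ioi (0:ℝ), R v * k v
  set d := ∫ v in Ioi (0:ℝ), k v * h v
  have key : ∀ y ∈ Ioi (0:ℝ), a - R y * d - h y * c + R y * h y * b ≤ 0 := by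
    intro y hy
    have e : a - R y * d - h y * c + R y * h y * b =
        ∫ x in Ioi (0:ℝ), (R x * (k x * h x) - R y * (k x * h x) - h y * (R x * k x)
          + R y * h y * k x) := by
      rw [integral_add, integral_sub, integral_sub, integral_const_mul, integral_const_mul,
        integral_const_mul]
      · exact i4
      · exact i2.const_mul _
      · exact i4.sub (i2.const_mul _)
      · exact i3.const_mul _
      · exact (i4.sub (i2.const_mul _)).sub (i3.const_mul _)
      · exact i1.const_mul _
    rw [e]
    apply setIntegral_nonpos measurableSet_Ioi
    intro x hx
    have : (R x * (k x * h x) - R y * (k x * h x) - h y * (R x * k x)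
          + R y * h y * k x) = k x * ((R x - R y) * (h x - h y)) := by ring
    rw [this]
    apply mul_nonpos_of_nonneg_of_nonpos (hk x hx).le
    rcases le_total x y with hxy | hxy
    · exact mul_nonpos_of_nonpos_of_nonneg (sub_nonpos.2 (hR hx hy hxy))
        (sub_nonneg.2 (hh hx hy hxy))
    · exact mul_nonpos_of_nonneg_of_nonpos (sub_nonneg.2 (hR hy hx hxy))
        (sub_nonpos.2 (hh hy hx hxy))
  have e2 : 2 * (a * b - c * d) = ∫ y in Ioi (0:ℝ), (a * k y - d * (R y * k y)
      - c * (k y * h y) + b * (R y * (k y * h y))) := by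
    rw [integral_add, integral_sub, integral_sub, integral_const_mul, integral_const_mul,
        integral_const_mul, integral_const_mul]
    · ring
    · exact i1.const_mul _
    · exact i3.const_mul _
    · exact (i1.const_mul _).sub (i3.const_mul _)
    · exact i2.const_mul _
    · exact ((i1.const_mul _).sub (i3.const_mul _)).sub (i2.const_mul _)
    · exact i4.const_mul _
  have : 2 * (a * b - c * d) ≤ 0 := by
    rw [e2]
    apply setIntegral_nonpos measurableSet_Ioi
    intro y hy
    have := mul_nonpos_of_nonneg_of_nonpos (hk y hy).le (key y hy)
    linarith
  linarith

theorem setInt_pos {k : ℝ → ℝ} {s : Set ℝ} (hs : MeasurableSet s) (hv : 0 < volume s)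
    (hk : ∀ v ∈ s, 0 < k v) (i : IntegrableOn k s) : 0 < ∫ v in s, k v := by
  rw [setIntegral_pos_iff_support_of_nonneg_ae]
  · refine lt_of_lt_of_le hv (measure_mono fun x hx => ⟨(hk x hx).ne', hx⟩)
  · exact eventually_of_mem (self_mem_ae_restrict hs) fun x hx => (hk x hx).le
  · exact i

theorem lim_aux (k : ℝ → ℝ → ℝ) (R f : ℝ → ℝ) (n0 : ℝ)
    (hk : ∀ n, n0 ≤ n → ∀ v ∈ Ioi (0:ℝ), 0 < k n v)
    (hf : ∀ v ∈ Ioi (0:ℝ), 0 < f v) (hfa : StrictAntiOn f (Ioi 0))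
    (hkf : ∀ n, n0 ≤ n → ∀ v ∈ Ioi (0:ℝ), k n v = k n0 v * f v ^ (n - n0))
    (hR : MonotoneOn R (Ioi 0)) (hR1 : ∀ v ∈ Ioi (0:ℝ), 1 ≤ R v)
    (hRl : Tendsto R (𝓝[>] 0) (𝓝 1))
    (i1 : ∀ n, n0 ≤ n → IntegrableOn (k n) (Ioi 0))
    (i2 : ∀ n, n0 ≤ n → IntegrableOn (fun v => R v * k n v) (Ioi 0)) :
    Tendsto (fun n => (∫ v in Ioi (0:ℝ), R v * k n v) / (∫ v in Ioi (0:ℝ), k n v))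
      atTop (𝓝 1) := by
  have hpos : ∀ n, n0 ≤ n → 0 < ∫ v in Ioi (0:ℝ), k n v := fun n hn =>
    setInt_pos measurableSet_Ioi (by simp) (hk n hn) (i1 n hn)
  refine tendsto_order.2 ⟨fun l hl => ?_, fun u hu => ?_⟩
  · filter_upwards [eventually_ge_atTop n0] with n hn
    refine lt_of_lt_of_le hl ((one_le_div (hpos n hn)).2 ?_)
    refine setIntegral_mono_on (i1 n hn) (i2 n hn) measurableSet_Ioi fun v hv => ?_
    nlinarith [hk n hn v hv, hR1 v hv]
  · obtain ⟨η, hη, hηu⟩ : ∃ η, 0 < η ∧ 1 + η < u := ⟨(u-1)/2, by linarith, by linarith⟩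
    have h1 : ∀ᶠ v in 𝓝[>] (0:ℝ), R v < 1 + η := (tendsto_order.1 hRl).2 _ (by linarith)
    obtain ⟨ε, hε1, hε⟩ := (h1.and self_mem_nhdsWithin).exists
    have hε : 0 < ε := hε
    have hε2 : 0 < ε / 2 := by linarith
    set C := ∫ v in Ioc 0 (ε/2), k n0 v with hC
    have hCpos : 0 < C := setInt_pos measurableSet_Ioc (by simp [hε])
      (fun v hv => hk n0 le_rfl v hv.1) ((i1 n0 le_rfl).mono_set Ioc_subset_Ioi_self)
    set L := ∫ v in Ioi (0:ℝ), R v * k n0 v with hL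
    have hLpos : 0 < L := setInt_pos measurableSet_Ioi (by simp)
      (fun v hv => mul_pos (by linarith [hR1 v hv]) (hk n0 le_rfl v hv)) (i2 n0 le_rfl)
    set ρ := f ε / f (ε/2) with hρ
    have hρ0 : 0 < ρ := div_pos (hf _ hε) (hf _ hε2)
    have hρ1 : ρ < 1 := (div_lt_one (hf _ hε2)).2 (hfa hε2 hε (by linarith))
    have ht : Tendsto (fun n : ℝ => 1 + η + ρ ^ (n - n0) * (L / C)) atTop (𝓝 (1 + η + 0 * (L/C))) := by
      refine tendsto_const_nhds.add (Tendsto.mul_const _ ?_)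
      exact (tendsto_rpow_atTop_of_base_lt_one ρ (by linarith) hρ1).comp
        (tendsto_atTop_add_const_right _ _ tendsto_id)
    have ht2 := (tendsto_order.1 ht).2 u (by linarith)
    filter_upwards [eventually_ge_atTop n0, ht2] with n hn hn2
    refine lt_of_le_of_lt ?_ hn2
    have hδ : 0 ≤ n - n0 := by linarith
    have b1 : (∫ v in Ioi (0:ℝ), R v * k n v) ≤ (1 + η) * (∫ v in Ioi (0:ℝ), k n v)
        + f ε ^ (n - n0) * L := by
      rw [hL, ← integral_const_mul, ← integral_const_mul, ← integral_add]
      · refine setIntegral_mono_on (i2 n hn) ?_ measurableSet_Ioi fun v hv => ?_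
        · exact ((i1 n hn).const_mul _).add ((i2 n0 le_rfl).const_mul _)
        have p1 := hk n hn v hv
        have p0 := hk n0 le_rfl v hv
        have r1 := hR1 v hv
        have q1 : 0 < f ε ^ (n - n0) := Real.rpow_pos_of_pos (hf _ hε) _
        rcases le_total v ε with hve | hve
        · have : R v ≤ 1 + η := (hR hv hε hve).trans hε1.le
          have : R v * k n v ≤ (1 + η) * k n v := by gcongr
          have : 0 < f ε ^ (n - n0) * (R v * k n0 v) := by positivity
          linarith
        · have : f v ^ (n - n0) ≤ f ε ^ (n - n0) :=
            Real.rpow_le_rpow (hf _ hv).le (hfa.antitoneOn hε hv hve) hδ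
          have h3 : R v * k n v ≤ f ε ^ (n - n0) * (R v * k n0 v) := by
            rw [hkf n hn v hv]
            calc R v * (k n0 v * f v ^ (n - n0)) = (R v * k n0 v) * f v ^ (n-n0) := by ring
              _ ≤ (R v * k n0 v) * f ε ^ (n-n0) := by gcongr
              _ = _ := by ring
          have : 0 < (1 + η) * k n v := by positivity
          linarith
      · exact (i1 n hn).const_mul _
      · exact (i2 n0 le_rfl).const_mul _
    have b2 : f (ε/2) ^ (n - n0) * C ≤ ∫ v in Ioi (0:ℝ), k n v := by
      calc f (ε/2) ^ (n - n0) * C ≤ ∫ v in Ioc 0 (ε/2), k n v := by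
            rw [hC, ← integral_const_mul]
            refine setIntegral_mono_on
              (((i1 n0 le_rfl).mono_set Ioc_subset_Ioi_self).const_mul _)
              ((i1 n hn).mono_set Ioc_subset_Ioi_self) measurableSet_Ioc fun v hv => ?_
            rw [hkf n hn v hv.1, mul_comm]
            have := hk n0 le_rfl v hv.1
            have : f (ε/2) ^ (n - n0) ≤ f v ^ (n - n0) :=
              Real.rpow_le_rpow (hf _ hε2).le (hfa.antitoneOn hv.1 hε2 hv.2) hδ
            gcongr
        _ ≤ _ := by
            refine setIntegral_mono_set (i1 n hn) ?_ (LE.le.eventuallyLE Ioc_subset_Ioi_self)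
            exact eventually_of_mem (self_mem_ae_restrict measurableSet_Ioi)
              fun x hx => (hk n hn x hx).le
    rw [div_le_iff₀ (hpos n hn)]
    refine b1.trans ?_
    rw [add_mul (1 + η)]
    refine add_le_add_right ?_ _
    have e : f ε ^ (n - n0) = ρ ^ (n - n0) * f (ε/2) ^ (n-n0) := by
      rw [hρ, Real.div_rpow (hf _ hε).le (hf _ hε2).le, div_mul_cancel₀]
      exact (Real.rpow_pos_of_pos (hf _ hε2) _).ne'
    calc f ε ^ (n - n0) * L = ρ ^ (n - n0) * (L / C) * (f (ε/2) ^ (n-n0) * C) := by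
          rw [e]; field_simp
      _ ≤ _ := by gcongr

noncomputable def GG (p v : ℝ) : ℝ :=
  (1 - p) * Real.exp (p * v) + p * Real.exp (-((1 - p) * v)) - 1

noncomputable def XX (p v : ℝ) : ℝ := (Real.exp (p * v) - 1) / (Real.exp v - 1)

noncomputable def DD (p v : ℝ) : ℝ := Real.exp v * GG p v / (Real.exp v - 1) ^ 2

theorem GG_deriv (p v : ℝ) : HasDerivAt (GG p)
    ((1 - p) * p * (Real.exp (p * v) - Real.exp (-((1 - p) * v)))) v := by
  have h1 : HasDerivAt (fun v => Real.exp (p * v)) (Real.exp (p * v) * (p * 1)) v :=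
    ((hasDerivAt_id v).const_mul p).exp
  have h2 : HasDerivAt (fun v => Real.exp (-((1 - p) * v)))
      (Real.exp (-((1 - p) * v)) * (-((1 - p) * 1))) v :=
    ((hasDerivAt_id v).const_mul (1 - p)).neg.exp
  convert! ((h1.const_mul (1 - p)).add (h2.const_mul p)).sub_const 1 using 1
  ring

theorem GG_zero (p : ℝ) : GG p 0 = 0 := by simp [GG]

theorem GG_cont (p : ℝ) : Continuous (GG p) := by unfold GG; fun_prop

theorem GG_pos {p v : ℝ} (hp0 : 0 < p) (hp1 : p < 1) (hv : 0 < v) : 0 < GG p v := by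
  have : StrictMonoOn (GG p) (Ici 0) := by
    apply strictMonoOn_of_deriv_pos (convex_Ici 0) (GG_cont p).continuousOn
    intro x hx
    rw [interior_Ici] at hx
    have hx : 0 < x := hx
    rw [(GG_deriv p x).deriv]
    have : Real.exp (-((1 - p) * x)) < Real.exp (p * x) := Real.exp_lt_exp.2 (by nlinarith)
    have := sub_pos.2 this
    have := sub_pos.2 hp1
    positivity
  have := this self_mem_Ici (mem_Ici.2 hv.le) hv
  rwa [GG_zero] at this

/-- relation between the derivatives -/
theorem GG_rel (p v : ℝ) : Real.exp ((1 - p) * v) - Real.exp (-(p * v)) =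
    Real.exp ((1 - 2 * p) * v) * (Real.exp (p * v) - Real.exp (-((1 - p) * v))) := by
  rw [mul_sub, ← Real.exp_add, ← Real.exp_add]
  congr 2 <;> ring

theorem GG_deriv' (p v : ℝ) : HasDerivAt (GG (1 - p))
    ((1 - p) * p * (Real.exp ((1 - 2 * p) * v) * (Real.exp (p * v) - Real.exp (-((1 - p) * v))))) v := by
  convert! GG_deriv (1 - p) v using 1
  rw [← GG_rel]; simp only [sub_sub_cancel]; ring

theorem GG_le {p v : ℝ} (hp0 : 0 < p) (hp1 : p < 1) (hp : p ≤ 1/2) (hv : 0 ≤ v) :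
    GG p v ≤ GG (1 - p) v := by
  have : MonotoneOn (fun v => GG (1 - p) v - GG p v) (Ici 0) := by
    apply monotoneOn_of_deriv_nonneg (convex_Ici 0)
    · exact ((GG_cont _).sub (GG_cont _)).continuousOn
    · exact fun x _ => ((GG_deriv' p x).sub (GG_deriv p x)).differentiableAt.differentiableWithinAt
    · intro x hx
      rw [interior_Ici] at hx
      have hx : 0 < x := hx
      rw [show deriv (fun v => GG (1 - p) v - GG p v) x = _ from
        HasDerivAt.deriv ((GG_deriv' p x).sub (GG_deriv p x))]
      have : Real.exp (-((1 - p) * x)) < Real.exp (p * x) := Real.exp_lt_exp.2 (by nlinarith)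
      have := sub_pos.2 this
      have := sub_pos.2 hp1
      have h1 : 0 ≤ Real.exp ((1 - 2 * p) * x) - 1 :=
        sub_nonneg.2 (Real.one_le_exp (by nlinarith))
      have : 0 ≤ (1 - p) * p * ((Real.exp ((1 - 2 * p) * x) - 1) * (Real.exp (p * x) - Real.exp (-((1 - p) * x)))) := by positivity
      linarith
  have := this self_mem_Ici (mem_Ici.2 hv) hv
  simp only [GG_zero] at this
  linarith

theorem GG_ge {p v : ℝ} (hp0 : 0 < p) (hp1 : p < 1) (hp : p ≤ 1/2) (hv : 0 ≤ v) :
    GG (1 - p) v ≤ Real.exp ((1 - 2 * p) * v) * GG p v := by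
  have hd : ∀ v, HasDerivAt (fun v => Real.exp ((1 - 2 * p) * v) * GG p v - GG (1 - p) v)
      ((1 - 2 * p) * Real.exp ((1 - 2 * p) * v) * GG p v) v := by
    intro v
    have h1 : HasDerivAt (fun v => Real.exp ((1 - 2 * p) * v)) (Real.exp ((1 - 2 * p) * v) * ((1 - 2 * p) * 1)) v :=
      ((hasDerivAt_id v).const_mul _).exp
    convert! (h1.mul (GG_deriv p v)).sub (GG_deriv' p v) using 1
    ring
  have : MonotoneOn (fun v => Real.exp ((1 - 2 * p) * v) * GG p v - GG (1 - p) v) (Ici 0) := by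
    apply monotoneOn_of_deriv_nonneg (convex_Ici 0)
    · exact fun x _ => (hd x).continuousAt.continuousWithinAt
    · exact fun x _ => (hd x).differentiableAt.differentiableWithinAt
    · intro x hx
      rw [interior_Ici] at hx
      have hx : 0 < x := hx
      rw [(hd x).deriv]
      have := GG_pos hp0 hp1 hx
      have : 0 ≤ 1 - 2 * p := by linarith
      positivity
  have := this self_mem_Ici (mem_Ici.2 hv) hv
  simp only [GG_zero] at this
  linarith

theorem GG_ratio_mono {p : ℝ} (hp0 : 0 < p) (hp1 : p < 1) (hp : p ≤ 1/2) :
    MonotoneOn (fun v => GG (1 - p) v / GG p v) (Ioi 0) := by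
  have hd : ∀ v ∈ Ioi (0:ℝ), HasDerivAt (fun v => GG (1 - p) v / GG p v) _ v := fun v hv =>
    (GG_deriv' p v).div (GG_deriv p v) (GG_pos hp0 hp1 hv).ne'
  apply monotoneOn_of_deriv_nonneg (convex_Ioi 0)
  · exact fun x hx => (hd x hx).continuousAt.continuousWithinAt
  · rw [interior_Ioi]
    exact fun x hx => (hd x hx).differentiableAt.differentiableWithinAt
  · rw [interior_Ioi]
    intro x hx
    rw [(hd x hx).deriv]
    have hx : 0 < x := hx
    apply div_nonneg _ (sq_nonneg _)
    have : Real.exp (-((1 - p) * x)) < Real.exp (p * x) := Real.exp_lt_exp.2 (by nlinarith)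
    have := sub_pos.2 this
    have := sub_pos.2 hp1
    have h1 := sub_nonneg.2 (GG_ge hp0 hp1 hp hx.le)
    have : 0 ≤ (1 - p) * p * (Real.exp (p * x) - Real.exp (-((1 - p) * x))) * (Real.exp ((1 - 2 * p) * x) * GG p x - GG (1 - p) x) := by positivity
    linarith

theorem exp_sub_pos {v : ℝ} (hv : 0 < v) : 0 < Real.exp v - 1 :=
  sub_pos.2 (Real.one_lt_exp_iff.2 hv)

theorem XX_deriv {p v : ℝ} (hv : 0 < v) : HasDerivAt (XX p) (-(DD p v)) v := by
  have h1 : HasDerivAt (fun v => Real.exp (p * v)) (Real.exp (p * v) * (p * 1)) v :=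
    ((hasDerivAt_id v).const_mul p).exp
  have h := exp_sub_pos hv
  convert! (h1.sub_const 1).div ((Real.hasDerivAt_exp v).sub_const 1) h.ne' using 1
  rw [DD, ← neg_div]
  congr 1
  have : Real.exp v * Real.exp (-((1 - p) * v)) = Real.exp (p * v) := by
    rw [← Real.exp_add]; congr 1; ring
  rw [GG]
  linear_combination -p * this

theorem DD_pos {p v : ℝ} (hp0 : 0 < p) (hp1 : p < 1) (hv : 0 < v) : 0 < DD p v := by
  have := GG_pos hp0 hp1 hv
  have := exp_sub_pos hv
  unfold DD; positivity

theorem XX_pos {p v : ℝ} (hp0 : 0 < p) (hv : 0 < v) : 0 < XX p v :=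
  div_pos (exp_sub_pos (by positivity)) (exp_sub_pos hv)

theorem one_sub_XX {p v : ℝ} (hv : 0 < v) :
    1 - XX p v = Real.exp (p * v) * XX (1 - p) v := by
  have h := exp_sub_pos hv
  unfold XX
  have : Real.exp v = Real.exp (p * v) * Real.exp ((1 - p) * v) := by
    rw [← Real.exp_add]; congr 1; ring
  rw [← mul_div_assoc, eq_div_iff h.ne', sub_mul, div_mul_cancel₀ _ h.ne']
  linear_combination this

theorem XX_lt_one {p v : ℝ} (hp1 : p < 1) (hv : 0 < v) : 0 < 1 - XX p v := by
  rw [one_sub_XX hv]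
  exact mul_pos (Real.exp_pos _) (XX_pos (by linarith) hv)

theorem XX_lt {p v : ℝ} (hp0 : 0 < p) (hp1 : p < 1) (hv : 0 < v) : XX p v < p := by
  have h := exp_sub_pos hv
  rw [XX, div_lt_iff₀ h]
  have := GG_pos (p := 1 - p) (by linarith) (by linarith) hv
  have h2 := mul_pos (Real.exp_pos (p * v)) this
  unfold GG at h2
  have e1 : Real.exp v = Real.exp (p * v) * Real.exp ((1 - p) * v) := by
    rw [← Real.exp_add]; congr 1; ring
  have e2 : Real.exp (p * v) * Real.exp (-(p * v)) = 1 := by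
    rw [← Real.exp_add]; simp
  simp only [sub_sub_cancel] at h2
  rw [e1]
  linear_combination h2 + (1 - p) * e2

theorem XX_anti {p : ℝ} (hp0 : 0 < p) (hp1 : p < 1) : StrictAntiOn (XX p) (Ioi 0) := by
  apply strictAntiOn_of_deriv_neg (convex_Ioi 0)
  · exact fun x hx => (XX_deriv hx).continuousAt.continuousWithinAt
  · rw [interior_Ioi]
    intro x hx
    rw [(XX_deriv hx).deriv]
    exact neg_lt_zero.2 (DD_pos hp0 hp1 hx)

theorem XX_zero {p : ℝ} : Tendsto (XX p) (𝓝[>] 0) (𝓝 p) := by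
  have h1 : HasDerivAt (fun v => Real.exp (p * v)) (Real.exp (p * 0) * (p * 1)) 0 :=
    ((hasDerivAt_id 0).const_mul p).exp
  have h2 := (Real.hasDerivAt_exp 0).tendsto_slope_zero_right
  have h1 := h1.tendsto_slope_zero_right
  simp only [zero_add, mul_zero, Real.exp_zero, one_mul, mul_one, smul_eq_mul] at h1 h2
  have := h1.div h2 one_ne_zero
  rw [div_one] at this
  refine this.congr' ?_
  filter_upwards [self_mem_nhdsWithin] with v hv
  have hv : 0 < v := hv
  have h := exp_sub_pos hv
  simp only [Pi.div_apply]
  unfold XX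
  field_simp

theorem XX_top {p : ℝ} (hp0 : 0 < p) (hp1 : p < 1) : Tendsto (XX p) atTop (𝓝 0) := by
  have : Tendsto (fun v => Real.exp (-((1 - p) * v))) atTop (𝓝 0) := by
    refine Real.tendsto_exp_neg_atTop_nhds_zero.comp ?_
    exact tendsto_id.const_mul_atTop (by linarith)
  refine squeeze_zero' (g := fun v => Real.exp (-((1 - p) * v))) ?_ ?_ this
  · filter_upwards [eventually_gt_atTop 0] with v hv using (XX_pos hp0 hv).le
  · filter_upwards [eventually_gt_atTop 0] with v hv
    have h1 := XX_lt_one (p := 1 - p) (by linarith) hv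
    have h2 := one_sub_XX (p := 1 - p) hv
    rw [sub_sub_cancel] at h2
    have h3 := XX_pos (p := 1 - p) (by linarith) hv
    have e2 : Real.exp ((1 - p) * v) * Real.exp (-((1 - p) * v)) = 1 := by
      rw [← Real.exp_add]; simp
    have h4 := Real.exp_pos (-((1 - p) * v))
    have : XX p v = Real.exp (-((1 - p) * v)) * (1 - XX (1-p) v) := by
      rw [h2]; linear_combination -XX p v * e2
    rw [this]
    nlinarith

theorem XX_image {p : ℝ} (hp0 : 0 < p) (hp1 : p < 1) : XX p '' Ioi 0 = Ioo 0 p := by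
  apply Subset.antisymm
  · rintro _ ⟨v, hv, rfl⟩
    exact ⟨XX_pos hp0 hv, XX_lt hp0 hp1 hv⟩
  · refine isPreconnected_Ioi.intermediate_value_Ioo (l₁ := atTop) (l₂ := 𝓝[>] 0) ?_ ?_ ?_
      (XX_top hp0 hp1) XX_zero
    · exact le_principal_iff.2 (Ioi_mem_atTop 0)
    · exact le_principal_iff.2 self_mem_nhdsWithin
    · exact fun x hx => (XX_deriv hx).continuousAt.continuousWithinAt

noncomputable def KK (p α β v : ℝ) : ℝ :=
  DD p v * ((XX p v) ^ (α - 1) * (1 - XX p v) ^ (β - 1))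

noncomputable def JJ (p α β : ℝ) : ℝ := ∫ v in Ioi (0:ℝ), KK p α β v

theorem beta_intble {α β : ℝ} (hα : 0 < α) (hβ : 0 < β) :
    IntervalIntegrable (fun x : ℝ => x ^ (α - 1) * (1 - x) ^ (β - 1)) volume 0 1 := by
  have h := Complex.betaIntegral_convergent (u := α) (v := β) (by simpa) (by simpa)
  rw [intervalIntegrable_iff_integrableOn_Ioc_of_le zero_le_one] at h ⊢
  refine IntegrableOn.congr_fun (f := fun x : ℝ => Complex.re
    ((x : ℂ) ^ ((α : ℂ) - 1) * (1 - (x : ℂ)) ^ ((β : ℂ) - 1))) h.re ?_ measurableSet_Ioc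
  intro x hx
  have h1 : 0 ≤ x := hx.1.le
  have h2 : 0 ≤ 1 - x := by linarith [hx.2]
  have e : (x : ℂ) ^ ((α : ℂ) - 1) * (1 - (x : ℂ)) ^ ((β : ℂ) - 1) =
      ((x ^ (α - 1) * (1 - x) ^ (β - 1) : ℝ) : ℂ) := by
    rw [Complex.ofReal_mul, Complex.ofReal_cpow h1, Complex.ofReal_cpow h2]
    push_cast
    rfl
  simp only [e, Complex.ofReal_re]

theorem KK_pos {p v : ℝ} (α β : ℝ) (hp0 : 0 < p) (hp1 : p < 1) (hv : 0 < v) :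
    0 < KK p α β v :=
  mul_pos (DD_pos hp0 hp1 hv) (mul_pos (Real.rpow_pos_of_pos (XX_pos hp0 hv) _)
    (Real.rpow_pos_of_pos (XX_lt_one hp1 hv) _))

theorem abs_DD {p : ℝ} (α β : ℝ) (hp0 : 0 < p) (hp1 : p < 1) :
    EqOn (fun v => |-(DD p v)| • ((XX p v) ^ (α - 1) * (1 - XX p v) ^ (β - 1)))
      (KK p α β) (Ioi 0) := by
  intro v hv
  simp only [abs_neg, smul_eq_mul, abs_of_pos (DD_pos hp0 hp1 hv), KK]

theorem KK_int {p α β : ℝ} (hp0 : 0 < p) (hp1 : p < 1) (hα : 0 < α) (hβ : 0 < β) :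
    IntegrableOn (KK p α β) (Ioi 0) := by
  have h := (intervalIntegrable_iff_integrableOn_Ioc_of_le zero_le_one).1 (beta_intble hα hβ)
  have h2 := h.mono_set (Ioo_subset_Ioc_self.trans (Ioc_subset_Ioc_right hp1.le) : Ioo 0 p ⊆ Ioc 0 1)
  rw [← XX_image hp0 hp1, integrableOn_image_iff_integrableOn_abs_deriv_smul measurableSet_Ioi
    (fun v hv => (XX_deriv hv).hasDerivWithinAt) (XX_anti hp0 hp1).injOn] at h2
  exact h2.congr_fun (abs_DD α β hp0 hp1) measurableSet_Ioi

theorem JJ_eq {p : ℝ} (α β : ℝ) (hp0 : 0 < p) (hp1 : p < 1) :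
    (∫ x in (0:ℝ)..p, x ^ (α - 1) * (1 - x) ^ (β - 1)) = JJ p α β := by
  rw [intervalIntegral.integral_of_le hp0.le, integral_Ioc_eq_integral_Ioo, ← XX_image hp0 hp1,
    integral_image_eq_integral_abs_deriv_smul measurableSet_Ioi
    (fun v hv => (XX_deriv hv).hasDerivWithinAt) (XX_anti hp0 hp1).injOn]
  exact setIntegral_congr_fun measurableSet_Ioi (abs_DD α β hp0 hp1)

theorem JJ_pos {p α β : ℝ} (hp0 : 0 < p) (hp1 : p < 1) (hα : 0 < α) (hβ : 0 < β) :
    0 < JJ p α β :=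
  setInt_pos measurableSet_Ioi (by simp) (fun _ hv => KK_pos α β hp0 hp1 hv)
    (KK_int hp0 hp1 hα hβ)

theorem betaCDF_eq {p α β : ℝ} (hp0 : 0 < p) (hp1 : p < 1) (hα : 0 < α) (hβ : 0 < β) :
    betaCDF α β p = JJ p α β / (JJ p α β + JJ (1 - p) β α) := by
  have h := beta_intble hα hβ
  have hm : p ∈ uIcc (0:ℝ) 1 := by rw [uIcc_of_le zero_le_one]; exact ⟨hp0.le, hp1.le⟩
  have e : (∫ x in p..1, x ^ (α - 1) * (1 - x) ^ (β - 1)) = JJ (1 - p) β α := by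
    rw [← JJ_eq β α (by linarith) (by linarith)]
    have := intervalIntegral.integral_comp_sub_left (a := 0) (b := 1 - p)
      (fun x : ℝ => x ^ (α - 1) * (1 - x) ^ (β - 1)) 1
    simp only [sub_sub_cancel, sub_zero] at this
    rw [← this]
    congr 1; ext x; ring
  rw [betaCDF, ← intervalIntegral.integral_add_adjacent_intervals
    (h.mono_set (uIcc_subset_uIcc_left hm)) (h.mono_set (uIcc_subset_uIcc_right hm)),
    JJ_eq α β hp0 hp1, e]

noncomputable def RR (p A v : ℝ) : ℝ := GG (1 - p) v / GG p v * Real.exp (A * v)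

theorem KK_swap {p v : ℝ} (α β : ℝ) (hp0 : 0 < p) (hp1 : p < 1) (hv : 0 < v) :
    KK (1 - p) β α v = RR p ((1 - p) * (α - 1) - p * (β - 1)) v * KK p α β v := by
  have hq := one_sub_XX (p := 1 - p) hv
  rw [sub_sub_cancel] at hq
  have x1 := XX_pos hp0 hv
  have x2 := XX_pos (p := 1 - p) (by linarith) hv
  have g := (GG_pos hp0 hp1 hv).ne'
  unfold KK RR DD
  rw [hq, one_sub_XX hv, Real.mul_rpow (Real.exp_pos _).le x1.le,
    Real.mul_rpow (Real.exp_pos _).le x2.le, ← Real.exp_mul, ← Real.exp_mul]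
  have : Real.exp (((1 - p) * v) * (α - 1)) =
      Real.exp (((1 - p) * (α - 1) - p * (β - 1)) * v) * Real.exp (p * v * (β - 1)) := by
    rw [← Real.exp_add]; congr 1; ring
  rw [this]
  have h := exp_sub_pos hv
  field_simp

theorem KK_pow {p v : ℝ} (a b n m : ℝ) (hp0 : 0 < p) (hp1 : p < 1) (hv : 0 < v) :
    KK p (p * m + a) ((1 - p) * m + b) v = KK p (p * n + a) ((1 - p) * n + b) v *
      ((XX p v) ^ p * (1 - XX p v) ^ (1 - p)) ^ (m - n) := by
  have x1 := XX_pos hp0 hv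
  have x2 := XX_lt_one hp1 hv
  unfold KK
  rw [Real.mul_rpow (Real.rpow_pos_of_pos x1 _).le (Real.rpow_pos_of_pos x2 _).le,
    ← Real.rpow_mul x1.le, ← Real.rpow_mul x2.le]
  have e1 : XX p v ^ (p * m + a - 1) = XX p v ^ (p * n + a - 1) * XX p v ^ (p * (m - n)) := by
    rw [← Real.rpow_add x1]; congr 1; ring
  have e2 : (1 - XX p v) ^ ((1 - p) * m + b - 1) =
      (1 - XX p v) ^ ((1 - p) * n + b - 1) * (1 - XX p v) ^ ((1 - p) * (m - n)) := by
    rw [← Real.rpow_add x2]; congr 1; ring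
  rw [e1, e2]; ring

theorem phi_mono {p : ℝ} (hp0 : 0 < p) (hp1 : p < 1) :
    StrictMonoOn (fun x : ℝ => x ^ p * (1 - x) ^ (1 - p)) (Ioo 0 p) := by
  have hl : StrictMonoOn (fun x : ℝ => p * Real.log x + (1 - p) * Real.log (1 - x)) (Ioo 0 p) := by
    have hd : ∀ x ∈ Ioo 0 p, HasDerivAt
        (fun x : ℝ => p * Real.log x + (1 - p) * Real.log (1 - x))
        (p * x⁻¹ + (1 - p) * (-1 / (1 - x))) x := by
      intro x hx
      have h2 : (1:ℝ) - x ≠ 0 := by have := hx.2; intro h; linarith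
      exact ((Real.hasDerivAt_log hx.1.ne').const_mul p).add
        ((((hasDerivAt_id x).const_sub 1).log h2).const_mul (1 - p))
    apply strictMonoOn_of_deriv_pos (convex_Ioo 0 p)
    · exact fun x hx => (hd x hx).continuousAt.continuousWithinAt
    · rw [interior_Ioo]
      intro x hx
      rw [(hd x hx).deriv]
      have h1 := hx.1
      have h2 : 0 < 1 - x := by linarith [hx.2]
      have : p * x⁻¹ + (1 - p) * (-1 / (1 - x)) = (p - x) / (x * (1 - x)) := by
        field_simp; ring
      rw [this]
      exact div_pos (by linarith [hx.2]) (by positivity)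
  have e : ∀ x ∈ Ioo 0 p, x ^ p * (1 - x) ^ (1 - p) =
      Real.exp (p * Real.log x + (1 - p) * Real.log (1 - x)) := by
    intro x hx
    rw [Real.rpow_def_of_pos hx.1, Real.rpow_def_of_pos (by linarith [hx.2]), ← Real.exp_add]
    congr 1; ring
  intro x hx y hy hxy
  simp only
  rw [e x hx, e y hy]
  exact Real.exp_lt_exp.2 (hl hx hy hxy)

theorem core {p a b : ℝ} (hp0 : 0 < p) (hp1 : p < 1) (hp : p ≤ 1 / 2)
    (hA : 0 ≤ (1 - p) * (a - 1) - p * (b - 1)) :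
    MonotoneOn (fun n : ℝ => betaCDF (p * n + a) ((1 - p) * n + b) p)
        {n : ℝ | 0 < p * n + a ∧ 0 < (1 - p) * n + b} ∧
    Filter.Tendsto (fun n : ℝ => betaCDF (p * n + a) ((1 - p) * n + b) p)
      Filter.atTop (nhds (1 / 2)) := by
  set A := (1 - p) * (a - 1) - p * (b - 1) with hAdef
  have hq0 : 0 < 1 - p := by linarith
  have hq1 : 1 - p < 1 := by linarith
  set f : ℝ → ℝ := fun v => (XX p v) ^ p * (1 - XX p v) ^ (1 - p) with hfdef
  have hfpos : ∀ v ∈ Ioi (0:ℝ), 0 < f v := fun v hv =>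
    mul_pos (Real.rpow_pos_of_pos (XX_pos hp0 hv) _) (Real.rpow_pos_of_pos (XX_lt_one hp1 hv) _)
  have hfa : StrictAntiOn f (Ioi 0) := fun x hx y hy hxy =>
    phi_mono hp0 hp1 ⟨XX_pos hp0 hy, XX_lt hp0 hp1 hy⟩ ⟨XX_pos hp0 hx, XX_lt hp0 hp1 hx⟩
      (XX_anti hp0 hp1 hx hy hxy)
  have hgr1 : ∀ v ∈ Ioi (0:ℝ), 1 ≤ GG (1 - p) v / GG p v := fun v hv =>
    (one_le_div (GG_pos hp0 hp1 hv)).2 (GG_le hp0 hp1 hp (le_of_lt hv))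
  have hRm : MonotoneOn (RR p A) (Ioi 0) := by
    intro x hx y hy hxy
    have h1 := GG_ratio_mono hp0 hp1 hp hx hy hxy
    have h2 : Real.exp (A * x) ≤ Real.exp (A * y) := Real.exp_le_exp.2 (by gcongr)
    exact mul_le_mul h1 h2 (Real.exp_pos _).le (zero_le_one.trans (hgr1 y hy))
  have hR1 : ∀ v ∈ Ioi (0:ℝ), 1 ≤ RR p A v := fun v hv =>
    one_le_mul_of_one_le_of_one_le (hgr1 v hv)
      (Real.one_le_exp (mul_nonneg hA (le_of_lt hv)))
  have hRl : Tendsto (RR p A) (𝓝[>] 0) (𝓝 1) := by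
    have ht : Tendsto (fun v => Real.exp ((1 - 2 * p) * v) * Real.exp (A * v)) (𝓝[>] 0) (𝓝 1) := by
      have : Continuous (fun v => Real.exp ((1 - 2 * p) * v) * Real.exp (A * v)) := by fun_prop
      have := this.tendsto 0
      simp only [mul_zero, Real.exp_zero, mul_one] at this
      exact this.mono_left nhdsWithin_le_nhds
    refine tendsto_of_tendsto_of_tendsto_of_le_of_le' tendsto_const_nhds ht ?_ ?_
    · filter_upwards [self_mem_nhdsWithin] with v hv using hR1 v hv
    · filter_upwards [self_mem_nhdsWithin] with v hv
      have := (div_le_iff₀ (GG_pos hp0 hp1 hv)).2 (GG_ge hp0 hp1 hp (le_of_lt hv))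
      unfold RR
      gcongr
  have hsw : ∀ n, EqOn (KK (1 - p) ((1 - p) * n + b) (p * n + a))
      (fun v => RR p A v * KK p (p * n + a) ((1 - p) * n + b) v) (Ioi 0) := by
    intro n v hv
    simp only
    rw [KK_swap _ _ hp0 hp1 hv]
    congr 2
    rw [hAdef]; ring
  have hJ : ∀ n, JJ (1 - p) ((1 - p) * n + b) (p * n + a) =
      ∫ v in Ioi (0:ℝ), RR p A v * KK p (p * n + a) ((1 - p) * n + b) v := fun n =>
    setIntegral_congr_fun measurableSet_Ioi (hsw n)
  have i2 : ∀ n, 0 < p * n + a → 0 < (1 - p) * n + b →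
      IntegrableOn (fun v => RR p A v * KK p (p * n + a) ((1 - p) * n + b) v) (Ioi 0) :=
    fun n h1 h2 => (KK_int hq0 hq1 h2 h1).congr_fun (hsw n) measurableSet_Ioi
  constructor
  · intro n hn m hm hnm
    obtain ⟨hn1, hn2⟩ := hn
    obtain ⟨hm1, hm2⟩ := hm
    simp only
    rw [betaCDF_eq hp0 hp1 hn1 hn2, betaCDF_eq hp0 hp1 hm1 hm2]
    have pw : EqOn (KK p (p * m + a) ((1 - p) * m + b))
      (fun v => KK p (p * n + a) ((1 - p) * n + b) v * (f v) ^ (m - n)) (Ioi 0) :=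
      fun v hv => KK_pow a b n m hp0 hp1 hv
    have pw2 : EqOn (fun v => RR p A v * KK p (p * m + a) ((1 - p) * m + b) v)
      (fun v => RR p A v * (KK p (p * n + a) ((1 - p) * n + b) v * (f v) ^ (m - n))) (Ioi 0) :=
      fun v hv => by simp only; rw [pw hv]
    have key := cheb_aux (KK p (p * n + a) ((1 - p) * n + b)) (RR p A) (fun v => f v ^ (m - n))
      (fun v hv => KK_pos _ _ hp0 hp1 hv) hRm
      (fun x hx y hy hxy => Real.rpow_le_rpow (hfpos y hy).le (hfa.antitoneOn hx hy hxy)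
        (by linarith))
      (KK_int hp0 hp1 hn1 hn2)
      ((KK_int hp0 hp1 hm1 hm2).congr_fun pw measurableSet_Ioi)
      (i2 n hn1 hn2) ((i2 m hm1 hm2).congr_fun pw2 measurableSet_Ioi)
    rw [← setIntegral_congr_fun measurableSet_Ioi pw,
      ← setIntegral_congr_fun measurableSet_Ioi pw2, ← hJ, ← hJ] at key
    change _ * JJ p (p * n + a) ((1 - p) * n + b) ≤ _ * JJ p (p * m + a) ((1 - p) * m + b) at key
    have q1 := JJ_pos hp0 hp1 hn1 hn2
    have q2 := JJ_pos hp0 hp1 hm1 hm2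
    have q3 := JJ_pos hq0 hq1 hn2 hn1
    have q4 := JJ_pos hq0 hq1 hm2 hm1
    rw [div_le_div_iff₀ (by positivity) (by positivity)]
    linarith
  · have ev : ∀ᶠ n : ℝ in atTop, ∀ m, n ≤ m → 0 < p * m + a ∧ 0 < (1 - p) * m + b := by
      filter_upwards [eventually_gt_atTop (-a / p), eventually_gt_atTop (-b / (1 - p))]
        with n h1 h2 m hnm
      have h1 := (div_lt_iff₀ hp0).1 (h1.trans_le hnm)
      have h2 := (div_lt_iff₀ hq0).1 (h2.trans_le hnm)
      constructor <;> linarith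
    obtain ⟨n0, hn0⟩ := ev.exists
    have hlim := lim_aux (fun n => KK p (p * n + a) ((1 - p) * n + b)) (RR p A) f n0
      (fun n hn v hv => KK_pos _ _ hp0 hp1 hv) hfpos hfa
      (fun n hn v hv => KK_pow a b n0 n hp0 hp1 hv) hRm hR1 hRl
      (fun n hn => KK_int hp0 hp1 (hn0 n hn).1 (hn0 n hn).2)
      (fun n hn => i2 n (hn0 n hn).1 (hn0 n hn).2)
    have h2 := (tendsto_const_nhds (x := (1:ℝ))).div (hlim.const_add 1) (by norm_num)
    rw [one_add_one_eq_two] at h2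
    refine h2.congr' ?_
    filter_upwards [eventually_ge_atTop n0] with n hn
    obtain ⟨hn1, hn2⟩ := hn0 n hn
    rw [betaCDF_eq hp0 hp1 hn1 hn2]
    simp only [Pi.div_apply]
    rw [← hJ]
    change 1 / (1 + _ / JJ p (p * n + a) ((1 - p) * n + b)) = _
    have q1 := JJ_pos hp0 hp1 hn1 hn2
    have q3 := JJ_pos hq0 hq1 hn2 hn1
    field_simp

theorem betaCDF_swap {p α β : ℝ} (hp0 : 0 < p) (hp1 : p < 1) (hα : 0 < α) (hβ : 0 < β) :
    betaCDF α β p = 1 - betaCDF β α (1 - p) := by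
  have q1 := JJ_pos hp0 hp1 hα hβ
  have q3 := JJ_pos (p := 1 - p) (by linarith) (by linarith) hβ hα
  rw [betaCDF_eq hp0 hp1 hα hβ, betaCDF_eq (by linarith) (by linarith) hβ hα, sub_sub_cancel]
  field_simp
  ring

end Aux


/-- Let `p ∈ (0,1)` and `a b : ℝ`, and for real `n` with `pn + a > 0` and
`(1-p)n + b > 0` let `W_n ~ Beta(pn + a, (1-p)n + b)`. Under the stated conditions on
`p`, `a`, `b`, the map `n ↦ P(W_n ≤ p)` is monotone on its domain and tends to `1/2`
as `n → ∞`. -/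
theorem stmt6 (p a b : ℝ) (hp : p ∈ Set.Ioo (0 : ℝ) 1)
    (hcond :
      (p ≤ 1 / 2 ∧ ((a ≥ 1 ∧ 1 ≥ b) ∨ (a + b - 2) * ((a - 1) / (a + b - 2) - p) > 0)) ∨
      (p ≥ 1 / 2 ∧ ((b ≥ 1 ∧ 1 ≥ a) ∨ (a + b - 2) * ((a - 1) / (a + b - 2) - p) < 0))) :
    (MonotoneOn (fun n : ℝ => betaCDF (p * n + a) ((1 - p) * n + b) p)
        {n : ℝ | 0 < p * n + a ∧ 0 < (1 - p) * n + b} ∨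
      AntitoneOn (fun n : ℝ => betaCDF (p * n + a) ((1 - p) * n + b) p)
        {n : ℝ | 0 < p * n + a ∧ 0 < (1 - p) * n + b}) ∧
    Filter.Tendsto (fun n : ℝ => betaCDF (p * n + a) ((1 - p) * n + b) p)
      Filter.atTop (nhds (1 / 2)) := by
  obtain ⟨hp0, hp1⟩ := hp
  have hq0 : 0 < 1 - p := by linarith
  have hq1 : 1 - p < 1 := by linarith
  have hAeq : a + b - 2 ≠ 0 → (a + b - 2) * ((a - 1) / (a + b - 2) - p) =
      (1 - p) * (a - 1) - p * (b - 1) := by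
    intro h; field_simp; ring
  rcases hcond with ⟨hp, h⟩ | ⟨hp, h⟩
  · have hA : 0 ≤ (1 - p) * (a - 1) - p * (b - 1) := by
      rcases h with ⟨h1, h2⟩ | h
      · nlinarith
      · by_cases h0 : a + b - 2 = 0
        · rw [h0] at h; simp at h
        · rw [hAeq h0] at h; exact le_of_lt h
    exact ⟨Or.inl (core hp0 hp1 hp hA).1, (core hp0 hp1 hp hA).2⟩
  · have hA : 0 ≤ (1 - (1 - p)) * (b - 1) - (1 - p) * (a - 1) := by
      rcases h with ⟨h1, h2⟩ | h
      · nlinarith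
      · by_cases h0 : a + b - 2 = 0
        · rw [h0] at h; simp at h
        · rw [hAeq h0] at h; linarith
    obtain ⟨c1, c2⟩ := core (p := 1 - p) (a := b) (b := a) hq0 hq1 (by linarith) hA
    simp only [sub_sub_cancel] at c1 c2
    constructor
    · right
      intro n hn m hm hnm
      simp only
      rw [betaCDF_swap hp0 hp1 hn.1 hn.2, betaCDF_swap hp0 hp1 hm.1 hm.2]
      have := c1 ⟨hn.2, hn.1⟩ ⟨hm.2, hm.1⟩ hnm
      simp only at this
      linarith
    · have h2 := c2.const_sub 1
      rw [show (1:ℝ) - 1/2 = 1/2 by norm_num] at h2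
      refine h2.congr' ?_
      filter_upwards [Filter.eventually_gt_atTop (-a / p), Filter.eventually_gt_atTop (-b / (1 - p))]
        with n h1 h2
      have h1 := (div_lt_iff₀ hp0).1 h1
      have h2 := (div_lt_iff₀ hq0).1 h2
      rw [betaCDF_swap hp0 hp1 (by linarith) (by linarith)]
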